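/- arXiv:2406.06956 — 2 statements merged into one kernel-verified Lean document; each statement's English description precedes it below -/
import Mathlib

section
/- The subshift (Σ, σ) has topological entropy zero, where Σ is the closure in {0,1}^ℕ of the union over l ≥ 0 of σ^l A. -/
/-- The left shift on `{0,1}^ℕ` (modelled inside `ℕ → ℕ`). -/
def shiftS (w : ℕ → ℕ) : ℕ → ℕ := fun n => w (n + 1)

/-- The set `A`: sequences of `0`'s and `1`'s with `w(i) = w(i+1)` whenever
`k³ ≤ i < (k+1)³ − 1` for some `k ≥ 1`. -/
def setA : Set (ℕ → ℕ) :=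
  {w | (∀ n, w n ≤ 1) ∧
    ∀ k, 1 ≤ k → ∀ i, k ^ 3 ≤ i → i < (k + 1) ^ 3 - 1 → w i = w (i + 1)}

/-- `Σ`: the closure of `∪_{l ≥ 0} σ^l A`. -/
def SigmaSet : Set (ℕ → ℕ) := closure (⋃ l : ℕ, shiftS^[l] '' setA)

open Dynamics Uniformity Topology

/-- The entourage of pairs of sequences that agree on their first `m` coordinates. -/
def agreementEntourage (m : ℕ) : SetRel (ℕ → ℕ) (ℕ → ℕ) :=
  {p | ∀ i < m, p.1 i = p.2 i}

instance agreementEntourage_isSymm (m : ℕ) : (agreementEntourage m).IsSymm :=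
  ⟨fun _ _ h i hi => (h i hi).symm⟩

lemma agreementEntourage_comp_subset (m : ℕ) :
    SetRel.comp (agreementEntourage m) (agreementEntourage m) ⊆ agreementEntourage m := by
  rintro ⟨x, z⟩ ⟨y, hxy, hyz⟩ i hi
  exact (hxy i hi).trans (hyz i hi)

lemma exists_agreementEntourage_subset {U : SetRel (ℕ → ℕ) (ℕ → ℕ)} (hU : U ∈ 𝓤 (ℕ → ℕ)) :
    ∃ m, agreementEntourage m ⊆ U := by
  have hN : 𝓤 ℕ = Filter.principal SetRel.id := rfl
  rw [Pi.uniformity] at hU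
  simp only [hN, Filter.comap_principal] at hU
  obtain ⟨t, ht, htU⟩ := (Filter.hasBasis_iInf_principal_finite _).mem_iff.1 hU
  obtain ⟨b, hb⟩ := ht.bddAbove
  refine ⟨b + 1, fun p hp => htU ?_⟩
  simp only [Set.mem_iInter]
  intro i hi
  exact hp i (Nat.lt_succ_of_le (hb hi))

lemma shiftS_iterate_apply (l : ℕ) (w : ℕ → ℕ) (i : ℕ) : shiftS^[l] w i = w (i + l) := by
  induction l generalizing i with
  | zero => rfl
  | succ l ih =>
    rw [Function.iterate_succ_apply']
    change shiftS^[l] w (i + 1) = _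
    rw [ih]
    congr 1
    omega

lemma continuous_shiftS : Continuous shiftS :=
  continuous_pi fun n => continuous_apply (n + 1)

lemma mapsTo_shiftS_SigmaSet : Set.MapsTo shiftS SigmaSet SigmaSet := by
  refine Set.MapsTo.closure ?_ continuous_shiftS
  intro x hx
  obtain ⟨l, a, ha, rfl⟩ := Set.mem_iUnion.1 hx
  exact Set.mem_iUnion.2 ⟨l + 1, a, ha, Function.iterate_succ_apply' _ _ _⟩

lemma SigmaSet_nonempty : SigmaSet.Nonempty :=
  ⟨0, subset_closure (Set.mem_iUnion.2 ⟨0, 0, ⟨by simp, by simp⟩, rfl⟩)⟩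

lemma exists_shift_eq_of_mem_SigmaSet {x : ℕ → ℕ} (hx : x ∈ SigmaSet) (N : ℕ) :
    ∃ l, ∃ a ∈ setA, ∀ i < N, x i = a (i + l) := by
  have hopen : IsOpen {y : ℕ → ℕ | ∀ i < N, x i = y i} := by
    have : {y : ℕ → ℕ | ∀ i < N, x i = y i} = ⋂ i ∈ Set.Iio N, {y | x i = y i} := by
      ext; simp
    rw [this]
    refine (Set.finite_Iio N).isOpen_biInter fun i _ => ?_
    exact (isOpen_discrete {n | x i = n}).preimage (continuous_apply i)
  obtain ⟨y, hy, hyu⟩ := mem_closure_iff.1 hx _ hopen fun i _ => rfl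
  obtain ⟨l, a, ha, rfl⟩ := Set.mem_iUnion.1 hyu
  exact ⟨l, a, ha, fun i hi => (hy i hi).trans (shiftS_iterate_apply l a i)⟩

lemma exists_eq_cube_of_ne {a : ℕ → ℕ} (ha : a ∈ setA) {i : ℕ} (hi : a i ≠ a (i + 1)) :
    ∃ c, i + 1 = c ^ 3 := by
  have hex : ∃ c, i < c ^ 3 :=
    ⟨i + 1, (Nat.lt_succ_self i).trans_le (Nat.le_self_pow (by simp) _)⟩
  classical
  obtain ⟨c, hc⟩ : ∃ c, Nat.find hex = c + 1 :=
    Nat.exists_eq_succ_of_ne_zero fun h => by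
      have := Nat.find_spec hex
      simp [h] at this
  have h1 : i < (c + 1) ^ 3 := hc ▸ Nat.find_spec hex
  have h2 : c ^ 3 ≤ i := not_lt.1 (Nat.find_min hex (by omega))
  refine ⟨c + 1, ?_⟩
  rcases Nat.eq_zero_or_pos c with rfl | hpos
  · simp at h1
    simp [h1]
  · by_contra hne
    exact hi (ha.2 c hpos i h2 (by omega))

open Classical in
/-- The sequence that starts with `b`, takes the value `(p j).2` at each positive position
`(p j).1`, and is constant between those positions. -/
noncomputable def stepSeq {ι : Type*} (b : ℕ) (p : ι → ℕ × ℕ) : ℕ → ℕ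
  | 0 => b
  | i + 1 => if h : ∃ j, (p j).1 = i + 1 then (p h.choose).2 else stepSeq b p i

lemma exists_stepSeq_eq {a : ℕ → ℕ} (ha : a ∈ setA) (l : ℕ) {N q : ℕ} (hN : N ≤ q ^ 3) :
    ∃ (b : Fin 2) (p : Fin q → Fin (N + 1) × Fin 2),
      ∀ i < N, stepSeq b (fun j => ((p j).1.1, (p j).2.1)) i = a (i + l) := by
  have hex : ∃ c, l < c ^ 3 :=
    ⟨l + 1, (Nat.lt_succ_self l).trans_le (Nat.le_self_pow (by simp) _)⟩
  classical
  obtain ⟨r, hr⟩ : ∃ r, Nat.find hex = r := ⟨_, rfl⟩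
  have hlr : l < r ^ 3 := hr ▸ Nat.find_spec hex
  have hbit (n : ℕ) : a n < 2 := Nat.lt_succ_of_le (ha.1 n)
  refine ⟨⟨a l, hbit l⟩, fun j => (⟨min ((r + j) ^ 3 - l) N, by omega⟩,
    ⟨a ((r + j) ^ 3), hbit _⟩), fun i hi => ?_⟩
  induction i with
  | zero => simp [stepSeq]
  | succ i ih =>
    rw [stepSeq]
    split_ifs with h
    · have hj := h.choose_spec
      generalize h.choose = j at hj
      change min ((r + j) ^ 3 - l) N = i + 1 at hj
      change a ((r + j) ^ 3) = _
      congr 1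
      omega
    · rw [ih (by omega)]
      by_contra hne
      rw [Nat.add_right_comm] at hne
      obtain ⟨c, hc⟩ := exists_eq_cube_of_ne ha hne
      have hrc : r ≤ c := hr ▸ Nat.find_min' hex (by omega)
      obtain ⟨j, rfl⟩ := Nat.exists_eq_add_of_le hrc
      have hjq : j < q := by
        by_contra! hqj
        have h1 : r ^ 3 + j ^ 3 ≤ (r + j) ^ 3 := pow_add_pow_le (by simp) (by simp) (by simp)
        have h2 : q ^ 3 ≤ j ^ 3 := Nat.pow_le_pow_left hqj 3
        omega
      refine h ⟨⟨j, hjq⟩, ?_⟩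
      change min ((r + j) ^ 3 - l) N = i + 1
      omega

lemma exists_isDynCoverOf_card_le (m : ℕ) {n q : ℕ} (h : n + m ≤ q ^ 3) :
    ∃ s : Finset (ℕ → ℕ), IsDynCoverOf shiftS SigmaSet (agreementEntourage m) n s ∧
      s.card ≤ 2 * ((n + m + 1) * 2) ^ q := by
  classical
  refine ⟨Finset.univ.image fun c : Fin 2 × (Fin q → Fin (n + m + 1) × Fin 2) =>
    stepSeq c.1.1 fun j => ((c.2 j).1.1, (c.2 j).2.1), ?_, ?_⟩
  · intro x hx
    obtain ⟨l, a, ha, hxa⟩ := exists_shift_eq_of_mem_SigmaSet hx (n + m)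
    obtain ⟨b, p, hp⟩ := exists_stepSeq_eq ha l h
    refine ⟨_, Finset.mem_coe.2 (Finset.mem_image_of_mem _ (Finset.mem_univ (b, p))), ?_⟩
    refine mem_dynEntourage.2 fun k hk i hi => ?_
    simp only [shiftS_iterate_apply]
    rw [hxa _ (by omega), hp _ (by omega)]
  · refine Finset.card_image_le.trans ?_
    simp

lemma log_card_bound (m : ℕ) {k : ℕ} (hk : 0 < k) :
    Real.log (2 * (((k ^ 3 : ℕ) + m + 1) * 2) ^ (k + m)) ≤ 4 * (m + 4) ^ 2 * k ^ 2 := by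
  have hk1 : (1 : ℝ) ≤ k := by exact_mod_cast hk
  have hm : (0 : ℝ) ≤ m := m.cast_nonneg
  set Q : ℝ := (m + 4) * k with hQ
  have hQ1 : 1 ≤ Q := by nlinarith
  have hbase : ((k ^ 3 : ℕ) + m + 1 : ℝ) * 2 ≤ Q ^ 3 := by
    have hk3 : (1 : ℝ) ≤ k ^ 3 := one_le_pow₀ hk1
    have h1 : ((k ^ 3 : ℕ) + m + 1 : ℝ) * 2 ≤ (2 * (m + 2)) * k ^ 3 := by
      push_cast
      nlinarith
    have h2 : (2 * (m + 2) : ℝ) ≤ (m + 4) ^ 3 := by nlinarith [pow_nonneg hm 3, pow_nonneg hm 2]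
    rw [hQ, mul_pow]
    exact h1.trans (by gcongr)
  have hlog : Real.log (((k ^ 3 : ℕ) + m + 1 : ℝ) * 2) ≤ 3 * Q := by
    refine (Real.log_le_log (by positivity) hbase).trans ?_
    rw [Real.log_pow]
    have := Real.log_le_self (x := Q) (by linarith)
    push_cast
    linarith
  have hkm : (k + m : ℝ) ≤ Q := by nlinarith
  rw [Real.log_mul (by norm_num) (by positivity), Real.log_pow]
  have h2 : Real.log 2 ≤ 1 := by linarith [Real.log_two_lt_d9]
  have h3 : ((k + m : ℕ) : ℝ) * Real.log (((k ^ 3 : ℕ) + m + 1 : ℝ) * 2) ≤ Q * (3 * Q) := by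
    push_cast at hlog ⊢
    exact mul_le_mul hkm hlog
      (Real.log_nonneg (by nlinarith [one_le_pow₀ (n := 3) hk1])) (by linarith)
  have h4 : 4 * ((m : ℝ) + 4) ^ 2 * k ^ 2 = 4 * Q ^ 2 := by rw [hQ]; ring
  rw [h4]
  nlinarith

lemma coverEntropyEntourage_agreementEntourage_le (m : ℕ) {k : ℕ} (hk : 0 < k) :
    coverEntropyEntourage shiftS SigmaSet
      (SetRel.comp (agreementEntourage m) (agreementEntourage m)) ≤
        ((4 * (m + 4) ^ 2 / k : ℝ) : EReal) := by
  have hN : k ^ 3 + m ≤ (k + m) ^ 3 := by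
    have h1 : k ^ 3 + m ^ 3 ≤ (k + m) ^ 3 := pow_add_pow_le (by simp) (by simp) (by simp)
    have h2 : m ≤ m ^ 3 := Nat.le_self_pow (by simp) m
    omega
  obtain ⟨s, hs, hcard⟩ := exists_isDynCoverOf_card_le m hN
  refine (hs.coverEntropyEntourage_le_log_card_div mapsTo_shiftS_SigmaSet (by positivity)).trans ?_
  have hlog : ENNReal.log s.card ≤ ((4 * (m + 4) ^ 2 * k ^ 2 : ℝ) : EReal) := by
    refine (ENNReal.log_monotone (b := ENNReal.ofReal
      (2 * (((k ^ 3 : ℕ) + m + 1) * 2) ^ (k + m))) ?_).trans ?_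
    · rw [← ENNReal.ofReal_natCast]
      exact ENNReal.ofReal_le_ofReal (by exact_mod_cast hcard)
    · rw [ENNReal.log_ofReal_of_pos (by positivity)]
      exact EReal.coe_le_coe (log_card_bound m hk)
  refine (EReal.monotone_div_right_of_nonneg (Nat.cast_nonneg' _) hlog).trans_eq ?_
  have hk0 : (k : ℝ) ≠ 0 := by positivity
  beta_reduce
  rw [show ((k ^ 3 : ℕ) : EReal) = (((k : ℝ) ^ 3 : ℝ) : EReal) by norm_cast, ← EReal.coe_div]
  congr 1
  field_simp

/-- the subshift `(Σ, σ)` has topological entropy zero. -/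
theorem stmt_10 : Dynamics.coverEntropy shiftS SigmaSet = 0 := by
  refine le_antisymm (iSup₂_le fun U hU => ?_) (coverEntropy_nonneg _ SigmaSet_nonempty)
  obtain ⟨m, hm⟩ := exists_agreementEntourage_subset hU
  refine (coverEntropyEntourage_antitone _ _ ((agreementEntourage_comp_subset m).trans hm)).trans ?_
  have hlim : Filter.Tendsto (fun k : ℕ => ((4 * (m + 4) ^ 2 / k : ℝ) : EReal)) Filter.atTop
      (𝓝 ((0 : ℝ) : EReal)) :=
    (continuous_coe_real_ereal.tendsto 0).comp (tendsto_const_div_atTop_nhds_zero_nat _)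
  refine ge_of_tendsto hlim ?_
  filter_upwards [Filter.eventually_gt_atTop 0] with k hk
  exact coverEntropyEntourage_agreementEntourage_le m hk
end

section
/- Let q : ℕ → ℕ with q_k ≥ 1 for all k and q_k → ∞, and let X be the associated subshift of the skew product system (Z,T). Then the topological dynamical system (X, T) has topological entropy zero. -/
/-- The left shift on one-sided sequences (indexed by positive integers). -/
def shiftN (y : ℕ → ℤ) : ℕ → ℤ := fun n => y (n + 1)

/-- The (invertible) shift by `m ∈ ℤ` on two-sided sequences: `(σ^m z)(n) = z(n + m)`. -/
def shiftZ (m : ℤ) (z : ℤ → ℤ) : ℤ → ℤ := fun n => z (n + m)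

/-- The skew product `T(y,z) = (σ y, σ^{y₁} z)` on `Z = {−1,0,1}^ℕ × {−1,1}^ℤ`. -/
def Tskew (p : (ℕ → ℤ) × (ℤ → ℤ)) : (ℕ → ℤ) × (ℤ → ℤ) :=
  (shiftN p.1, shiftZ (p.1 1) p.2)

open Classical in
/-- The sequence `s_{k,q} : ℕ → {0,1}` (viewed in `ℤ`), equal to `1` exactly at the
points `k³ + j·q` with `0 ≤ j ≤ ⌊((k+1)³ − k³)/q⌋ − 1`. -/
noncomputable def skq (k q : ℕ) (n : ℕ) : ℤ :=
  if ∃ j : ℕ, j + 1 ≤ ((k + 1) ^ 3 - k ^ 3) / q ∧ n = k ^ 3 + j * q then 1 else 0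

/-- `σ^{−p} x`: the sequence equal to `0` in its first `p` entries and with
`(σ^{−p}x)(n) = x(n−p)` for `n > p`. -/
def shiftDown (p : ℕ) (x : ℕ → ℤ) : ℕ → ℤ := fun n => if p < n then x (n - p) else 0

/-- The set `P` associated to `q : ℕ → ℕ`: `{−1,0,1}`-valued sequences whose
restriction to each block `[k³, (k+1)³)` is the corresponding restriction of
`σ^{−p} s_{k,q_k}` for some `0 ≤ p ≤ q_k`. -/
def setP (q : ℕ → ℕ) : Set (ℕ → ℤ) :=
  {y | (∀ n, y n = -1 ∨ y n = 0 ∨ y n = 1) ∧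
    ∀ k, 1 ≤ k → ∃ p, p ≤ q k ∧
      ∀ n, k ^ 3 ≤ n → n < (k + 1) ^ 3 → y n = shiftDown p (skq k (q k)) n}

/-- The set `{−1,1}^ℤ` of two-sided `±1`-valued sequences. -/
def setPM : Set (ℤ → ℤ) := {z | ∀ m, z m = -1 ∨ z m = 1}

/-- The subshift `X`: closure of `∪_{n ≥ 0} T^n (P × {−1,1}^ℤ)` in `Z`. -/
def setX (q : ℕ → ℕ) : Set ((ℕ → ℤ) × (ℤ → ℤ)) :=
  closure (⋃ n : ℕ, Tskew^[n] '' (setP q ×ˢ setPM))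

open Filter Uniformity Topology

/-- Pairs `(v, w)` with `v` valued in `{-1, 0, 1}` and `w` valued in `{-1, 1}`, such that any
`Q` consecutive entries of `v` beyond index `B` include at most two nonzero ones. -/
def sparseSet (B Q : ℕ) : Set ((ℕ → ℤ) × (ℤ → ℤ)) :=
  {x | (∀ i, x.1 i = -1 ∨ x.1 i = 0 ∨ x.1 i = 1) ∧
    (∀ i j l, B ≤ i → i < j → j < l → l < i + Q → x.1 i * x.1 j * x.1 l = 0) ∧
    x.2 ∈ setPM}

theorem isClosed_sparseSet (B Q : ℕ) : IsClosed (sparseSet B Q) := by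
  have h1 : ∀ i, Continuous fun x : (ℕ → ℤ) × (ℤ → ℤ) => x.1 i := fun i =>
    (continuous_apply i).comp continuous_fst
  simp only [sparseSet, setPM, Set.ofPred_and, Set.ofPred_forall]
  refine IsClosed.inter (isClosed_iInter fun i => ?_) (IsClosed.inter ?_ ?_)
  · exact (isClosed_discrete {a : ℤ | a = -1 ∨ a = 0 ∨ a = 1}).preimage (h1 i)
  · refine isClosed_iInter fun i => isClosed_iInter fun j => isClosed_iInter fun l =>
      isClosed_iInter fun _ => isClosed_iInter fun _ => isClosed_iInter fun _ =>
      isClosed_iInter fun _ => isClosed_eq (((h1 i).mul (h1 j)).mul (h1 l)) continuous_const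
  · have hPM : IsClosed (⋂ i : ℤ, {z : ℤ → ℤ | z i = -1 ∨ z i = 1}) := isClosed_iInter fun i =>
      (isClosed_discrete {a : ℤ | a = -1 ∨ a = 1}).preimage
        (continuous_apply (A := fun _ : ℤ => ℤ) i)
    exact hPM.preimage continuous_snd

theorem mapsTo_Tskew_sparseSet (B Q : ℕ) :
    Set.MapsTo Tskew (sparseSet B Q) (sparseSet B Q) := by
  rintro ⟨v, w⟩ ⟨h1, h2, h3⟩
  refine ⟨fun i => h1 (i + 1), fun i j l hi hij hjl hl => ?_, fun m => h3 _⟩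
  exact h2 (i + 1) (j + 1) (l + 1) (by omega) (by omega) (by omega) (by omega)

theorem Tskew_iterate (n : ℕ) (x : (ℕ → ℤ) × (ℤ → ℤ)) :
    Tskew^[n] x =
      (fun i => x.1 (i + n), fun j => x.2 (j + ∑ i ∈ Finset.range n, x.1 (i + 1))) := by
  induction n with
  | zero => simp
  | succ n ih =>
    rw [Function.iterate_succ_apply', ih]
    ext i
    · simp only [Tskew, shiftN, add_assoc, add_comm 1 n]
    · simp only [Tskew, shiftZ, Finset.sum_range_succ]
      rw [add_comm 1 n, add_assoc, add_comm (x.1 (n + 1))]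

theorem exists_cube_le_lt {K n : ℕ} (h : K ^ 3 ≤ n) :
    ∃ k, K ≤ k ∧ k ^ 3 ≤ n ∧ n < (k + 1) ^ 3 := by
  induction n, h using Nat.le_induction with
  | base => exact ⟨K, le_rfl, le_rfl, Nat.pow_lt_pow_left (by omega) (by omega)⟩
  | succ n _ ih =>
    obtain ⟨k, hk, h1, h2⟩ := ih
    rcases Nat.lt_or_ge (n + 1) ((k + 1) ^ 3) with h | h
    · exact ⟨k, hk, by omega, h⟩
    · exact ⟨k + 1, by omega, h,
        lt_of_le_of_lt h2 (Nat.pow_lt_pow_left (by omega) (by omega))⟩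

theorem eq_of_cube_le_lt {k l n : ℕ} (h1 : k ^ 3 ≤ n) (h2 : n < (k + 1) ^ 3)
    (h3 : l ^ 3 ≤ n) (h4 : n < (l + 1) ^ 3) : k = l := by
  have := lt_of_pow_lt_pow_left₀ 3 (by omega) (h1.trans_lt h4)
  have := lt_of_pow_lt_pow_left₀ 3 (by omega) (h3.trans_lt h2)
  omega

theorem setP_nonempty (q : ℕ → ℕ) : (setP q).Nonempty := by
  have h : ∀ n : ℕ, ∃ k, 0 ≤ k ∧ k ^ 3 ≤ n ∧ n < (k + 1) ^ 3 := fun n =>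
    exists_cube_le_lt (by simp)
  choose f _ hf1 hf2 using h
  refine ⟨fun n => shiftDown 0 (skq (f n) (q (f n))) n, fun n => ?_, fun k _ =>
    ⟨0, Nat.zero_le _, fun n hn1 hn2 => ?_⟩⟩
  · simp only [shiftDown, skq]
    split_ifs <;> simp
  · dsimp only
    rw [eq_of_cube_le_lt (hf1 n) (hf2 n) hn1 hn2]

theorem skq_ne_zero {k q n : ℕ} (h : skq k q n ≠ 0) : ∃ j : ℕ, n = k ^ 3 + j * q := by
  unfold skq at h
  split_ifs at h with h'
  · obtain ⟨j, _, hj⟩ := h'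
    exact ⟨j, hj⟩
  · simp at h

/-- Nonzero entries in the same block are at distance at least `q k`. -/
theorem add_le_of_setP_ne_zero {q : ℕ → ℕ} {y : ℕ → ℤ} (hy : y ∈ setP q) {k n m : ℕ}
    (hk : 1 ≤ k) (hn : k ^ 3 ≤ n) (hnm : n < m) (hm : m < (k + 1) ^ 3)
    (hyn : y n ≠ 0) (hym : y m ≠ 0) : n + q k ≤ m := by
  obtain ⟨p, _, h⟩ := hy.2 k hk
  rw [h n hn (hnm.trans hm)] at hyn
  rw [h m (hn.trans hnm.le) hm] at hym
  unfold shiftDown at hyn hym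
  split_ifs at hyn hym with h1 h2 h2
  all_goals try contradiction
  obtain ⟨i, hi⟩ := skq_ne_zero hyn
  obtain ⟨j, hj⟩ := skq_ne_zero hym
  have hij : i < j := by
    by_contra hc
    have := Nat.mul_le_mul_right (q k) (not_lt.mp hc)
    omega
  have := Nat.mul_le_mul_right (q k) (Nat.succ_le_of_lt hij)
  rw [Nat.succ_mul] at this
  omega

theorem exists_setX_subset_sparseSet {q : ℕ → ℕ} (hq : Tendsto q atTop atTop) (Q : ℕ) :
    ∃ B₀, ∀ B, B₀ ≤ B → setX q ⊆ sparseSet B Q := by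
  obtain ⟨K₀, hK₀⟩ := (hq.eventually_ge_atTop Q).exists_forall_of_atTop
  obtain ⟨K, hK, hK1, hKQ⟩ : ∃ K, (∀ k, K ≤ k → Q ≤ q k) ∧ 1 ≤ K ∧ Q ≤ K :=
    ⟨K₀ + Q + 1, fun k hk => hK₀ k (by omega), by omega, by omega⟩
  refine ⟨K ^ 3, fun B hB => closure_minimal ?_ (isClosed_sparseSet B Q)⟩
  refine Set.iUnion_subset fun m => ?_
  rintro _ ⟨⟨y, z⟩, ⟨hy, hz⟩, rfl⟩
  rw [Tskew_iterate]
  refine ⟨fun i => hy.1 _, fun i j l hi hij hjl hl => ?_, fun _ => hz _⟩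
  by_contra hne
  simp only [mul_eq_zero, not_or] at hne
  obtain ⟨⟨hyi, hyj⟩, hyl⟩ := hne
  obtain ⟨k, hk, h1, h2⟩ := exists_cube_le_lt (K := K) (n := i + m) (by omega)
  rcases Nat.lt_or_ge (j + m) ((k + 1) ^ 3) with h | h
  · have := add_le_of_setP_ne_zero hy (by omega) h1 (by omega) h hyi hyj
    have := hK k hk
    omega
  · have h3 : (k + 1) ^ 3 + Q ≤ (k + 1 + 1) ^ 3 := by nlinarith [sq_nonneg (k : ℤ)]
    have := add_le_of_setP_ne_zero hy (k := k + 1) (by omega) h (by omega : j + m < l + m)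
      (by omega) hyj hyl
    have := hK (k + 1) (by omega)
    omega

theorem exists_agree_of_mem_uniformity {V : Set (((ℕ → ℤ) × (ℤ → ℤ)) × ((ℕ → ℤ) × (ℤ → ℤ)))}
    (hV : V ∈ 𝓤 ((ℕ → ℤ) × (ℤ → ℤ))) :
    ∃ M : ℕ, ∀ x x' : (ℕ → ℤ) × (ℤ → ℤ), (∀ i ≤ M, x.1 i = x'.1 i) →
      (∀ j : ℤ, |j| ≤ M → x.2 j = x'.2 j) → (x, x') ∈ V := by
  let S : ℕ → Set (((ℕ → ℤ) × (ℤ → ℤ)) × ((ℕ → ℤ) × (ℤ → ℤ))) := fun M =>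
    {p | (∀ i ≤ M, p.1.1 i = p.2.1 i) ∧ ∀ j : ℤ, |j| ≤ M → p.1.2 j = p.2.2 j}
  have hS : Antitone S := fun M N hMN p hp =>
    ⟨fun i hi => hp.1 i (hi.trans hMN), fun j hj => hp.2 j (hj.trans (by exact_mod_cast hMN))⟩
  have hle : ⨅ M, 𝓟 (S M) ≤ 𝓤 ((ℕ → ℤ) × (ℤ → ℤ)) := by
    rw [uniformity_prod, Pi.uniformity, Pi.uniformity]
    simp only [Filter.comap_iInf, Filter.comap_comap]
    refine le_inf (le_iInf fun i => ?_) (le_iInf fun j => ?_)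
    · refine (iInf_le _ i).trans ?_
      rintro W ⟨t, ht, htW⟩
      refine mem_principal.2 fun p hp => htW ?_
      have := hp.1 i le_rfl
      simp only [Set.mem_preimage, Function.comp_apply, this]
      exact refl_mem_uniformity ht
    · refine (iInf_le _ j.natAbs).trans ?_
      rintro W ⟨t, ht, htW⟩
      refine mem_principal.2 fun p hp => htW ?_
      have := hp.2 j (by simp)
      simp only [Set.mem_preimage, Function.comp_apply, this]
      exact refl_mem_uniformity ht
  obtain ⟨M, hM⟩ := (mem_iInf_of_directed (f := fun M => 𝓟 (S M))
    (fun M N => ⟨max M N, principal_mono.2 (hS (le_max_left _ _)),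
      principal_mono.2 (hS (le_max_right _ _))⟩) V).1 (hle hV)
  exact ⟨M, fun x x' h1 h2 => hM ⟨h1, h2⟩⟩

/-- The bijection of `Fin 3` with `{-1, 0, 1}`. -/
def tritVal (c : Fin 3) : ℤ := (c : ℤ) - 1

theorem exists_tritVal {a : ℤ} (h : a = -1 ∨ a = 0 ∨ a = 1) : ∃ c, tritVal c = a := by
  rcases h with rfl | rfl | rfl
  · exact ⟨0, rfl⟩
  · exact ⟨1, rfl⟩
  · exact ⟨2, rfl⟩

theorem exists_eq_zero_off_pair {Q : ℕ} [NeZero Q] {f : ℕ → ℤ}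
    (h : ∀ i j l, i < j → j < l → l < Q → f i * f j * f l = 0) :
    ∃ p₁ p₂ : Fin Q, ∀ r < Q, r ≠ p₁ → r ≠ p₂ → f r = 0 := by
  by_cases h0 : ∃ p < Q, f p ≠ 0
  · obtain ⟨p, hp, hfp⟩ := h0
    by_cases h1 : ∃ p' < Q, p' ≠ p ∧ f p' ≠ 0
    · obtain ⟨p', hp', hne, hfp'⟩ := h1
      refine ⟨⟨p, hp⟩, ⟨p', hp'⟩, fun r hr h1 h2 => ?_⟩
      simp only at h1 h2
      by_contra hfr
      have key : ∀ i j l, i < j → j < l → l < Q → f i = 0 ∨ f j = 0 ∨ f l = 0 := by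
        intro i j l hij hjl hl
        simpa [or_assoc] using h i j l hij hjl hl
      rcases lt_or_gt_of_ne h1 with a | a <;> rcases lt_or_gt_of_ne h2 with b | b <;>
        rcases lt_or_gt_of_ne hne with c | c <;> grind
    · push Not at h1
      exact ⟨⟨p, hp⟩, ⟨p, hp⟩, fun r hr h _ => h1 r hr h⟩
  · push Not at h0
    exact ⟨0, 0, fun r hr _ _ => h0 r hr⟩

theorem exists_window_pair {B Q : ℕ} [NeZero Q] {x : (ℕ → ℤ) × (ℤ → ℤ)}
    (hx : x ∈ sparseSet B Q) {a : ℕ} (ha : B ≤ a) :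
    ∃ p₁ p₂ : Fin Q, ∀ r < Q, r ≠ p₁ → r ≠ p₂ → x.1 (a + r) = 0 :=
  exists_eq_zero_off_pair (f := fun r => x.1 (a + r)) fun i j l hij hjl hl =>
    hx.2.1 _ _ _ (by omega) (by omega) (by omega) (by omega)

theorem sum_abs_le_of_mem_sparseSet {B Q : ℕ} [NeZero Q] {x : (ℕ → ℤ) × (ℤ → ℤ)}
    (hx : x ∈ sparseSet B Q) (N : ℕ) :
    ∑ i ∈ Finset.range (B + N * Q), |x.1 i| ≤ B + 2 * N := by
  have habs : ∀ i, |x.1 i| ≤ 1 := fun i => by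
    rcases hx.1 i with h | h | h <;> simp [h]
  induction N with
  | zero =>
    simpa using Finset.sum_le_sum (s := Finset.range B) fun i _ => habs i
  | succ N ih =>
    rw [Nat.succ_mul, ← add_assoc, Finset.sum_range_add]
    obtain ⟨p₁, p₂, hp⟩ := exists_window_pair hx (a := B + N * Q) (by omega)
    have : ∑ r ∈ Finset.range Q, |x.1 (B + N * Q + r)| ≤
        ∑ r ∈ Finset.range Q, ((if r = p₁ then 1 else 0) + (if r = p₂ then 1 else 0)) := by
      refine Finset.sum_le_sum fun r hr => ?_
      have := habs (B + N * Q + r)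
      have := hp r (Finset.mem_range.1 hr)
      split_ifs with h1 h2 h2
      · omega
      · omega
      · omega
      · simp [this h1 h2]
    rw [Finset.sum_add_distrib, Finset.sum_ite_eq', Finset.sum_ite_eq'] at this
    simp only [Finset.mem_range, p₁.2, p₂.2, if_true] at this
    push_cast
    linarith

/-- Finite codes: the first `B` entries, then `N` windows with at most two nonzero entries,
then the central `2 R + 1` entries of the second component. -/
abbrev SparseCode (B Q N R : ℕ) : Type :=
  (Fin B → Fin 3) × (Fin N → (Fin Q × Fin Q) × (Fin 3 × Fin 3)) × (Fin (2 * R + 1) → Fin 3)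

/-- The point determined by a code, extended by zeros. -/
def SparseCode.decode {B Q N R : ℕ} (c : SparseCode B Q N R) : (ℕ → ℤ) × (ℤ → ℤ) :=
  (fun i => if h : i < B then tritVal (c.1 ⟨i, h⟩) else
      if h' : (i - B) / Q < N then
        let d := c.2.1 ⟨(i - B) / Q, h'⟩
        if (i - B) % Q = d.1.1 then tritVal d.2.1 else
          if (i - B) % Q = d.1.2 then tritVal d.2.2 else 0
      else 0,
    fun j => if h : (j + R).toNat < 2 * R + 1 then tritVal (c.2.2 ⟨(j + R).toNat, h⟩) else 0)

theorem exists_decode_agree {B Q : ℕ} [NeZero Q] {x : (ℕ → ℤ) × (ℤ → ℤ)}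
    (hx : x ∈ sparseSet B Q) (N R : ℕ) :
    ∃ c : SparseCode B Q N R, (∀ i < B + N * Q, x.1 i = c.decode.1 i) ∧
      ∀ j : ℤ, |j| ≤ R → x.2 j = c.decode.2 j := by
  choose f hf using fun i => exists_tritVal (hx.1 i)
  have hz : ∀ j, ∃ c, tritVal c = x.2 j := fun j =>
    exists_tritVal (by rcases hx.2.2 j with h | h <;> simp [h])
  choose g hg using hz
  choose p₁ p₂ hp using fun t : ℕ => exists_window_pair hx (a := B + t * Q) (by omega)
  refine ⟨(fun i => f i, fun t => ((p₁ t, p₂ t),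
    (f (B + t * Q + p₁ t), f (B + t * Q + p₂ t))), fun j => g ((j : ℤ) - R)), ?_, ?_⟩
  · intro i hi
    by_cases h : i < B
    · simp [SparseCode.decode, h, hf]
    · have hQ : 0 < Q := Nat.pos_of_neZero Q
      have h' : (i - B) / Q < N := (Nat.div_lt_iff_lt_mul hQ).2 (by omega)
      have hmod := Nat.mod_lt (i - B) hQ
      have hdm : (i - B) / Q * Q + (i - B) % Q = i - B := Nat.div_add_mod' _ _
      have hi' : i = B + (i - B) / Q * Q + (i - B) % Q := by omega
      simp only [SparseCode.decode, h, h', dif_pos, dif_neg, not_false_eq_true, hf]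
      split_ifs with h1 h2
      · rw [← h1, ← hi']
      · rw [← h2, ← hi']
      · rw [hi']
        exact hp _ _ hmod h1 h2
  · intro j hj
    rw [abs_le] at hj
    have h : (j + R).toNat < 2 * R + 1 := by omega
    simp only [SparseCode.decode, h, dif_pos, hg]
    rw [show ((j + R).toNat : ℤ) - R = j by omega]

theorem card_sparseCode (B Q N R : ℕ) :
    Fintype.card (SparseCode B Q N R) = 3 ^ (B + 2 * R + 1) * (9 * Q ^ 2) ^ N := by
  simp only [SparseCode, Fintype.card_prod, Fintype.card_pi, Fintype.card_fin,
    Finset.prod_const, Finset.card_univ]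
  rw [show Q * Q * (3 * 3) = 9 * Q ^ 2 by ring]
  ring

theorem exists_isDynCoverOf_sparseSet {B Q M : ℕ} [NeZero Q] (hM : M ≤ B) (N : ℕ)
    {V : Set (((ℕ → ℤ) × (ℤ → ℤ)) × ((ℕ → ℤ) × (ℤ → ℤ)))}
    (hV : ∀ x x' : (ℕ → ℤ) × (ℤ → ℤ), (∀ i ≤ M, x.1 i = x'.1 i) →
      (∀ j : ℤ, |j| ≤ M → x.2 j = x'.2 j) → (x, x') ∈ V) :
    ∃ s : Finset ((ℕ → ℤ) × (ℤ → ℤ)), Dynamics.IsDynCoverOf Tskew (sparseSet B Q) V (N * Q) s ∧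
      s.card ≤ 3 ^ (B + 2 * (M + B + 2 * N) + 1) * (9 * Q ^ 2) ^ N := by
  classical
  refine ⟨Finset.univ.image (SparseCode.decode (B := B) (Q := Q) (N := N) (R := M + B + 2 * N)),
    fun x hx => ?_, ?_⟩
  · obtain ⟨c, hc1, hc2⟩ := exists_decode_agree hx N (M + B + 2 * N)
    refine ⟨c.decode, by simp, ?_⟩
    rw [Dynamics.mem_dynEntourage]
    intro k hk
    rw [Tskew_iterate, Tskew_iterate]
    have hsum : ∑ i ∈ Finset.range k, c.decode.1 (i + 1) =
        ∑ i ∈ Finset.range k, x.1 (i + 1) := Finset.sum_congr rfl fun i hi => by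
      rw [Finset.mem_range] at hi
      rw [hc1 _ (by omega)]
    have hbound : |∑ i ∈ Finset.range k, x.1 (i + 1)| ≤ B + 2 * N := by
      calc |∑ i ∈ Finset.range k, x.1 (i + 1)|
          ≤ ∑ i ∈ Finset.range k, |x.1 (i + 1)| := Finset.abs_sum_le_sum_abs _ _
        _ ≤ ∑ i ∈ Finset.range (k + 1), |x.1 i| := by
          rw [Finset.sum_range_succ']
          exact le_add_of_nonneg_right (abs_nonneg _)
        _ ≤ ∑ i ∈ Finset.range (B + N * Q), |x.1 i| :=
          Finset.sum_le_sum_of_subset_of_nonneg (Finset.range_mono (by omega))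
            fun _ _ _ => abs_nonneg _
        _ ≤ B + 2 * N := sum_abs_le_of_mem_sparseSet hx N
    refine hV _ _ (fun i hi => hc1 _ (by omega)) fun j hj => ?_
    simp only [hsum]
    refine hc2 _ ((abs_add_le _ _).trans ?_)
    push_cast
    linarith
  · exact Finset.card_image_le.trans (card_sparseCode _ _ _ _).le

theorem coverEntropy_setX_le {q : ℕ → ℕ} (hq : Tendsto q atTop atTop) (Q : ℕ) [NeZero Q] :
    Dynamics.coverEntropy Tskew (setX q) ≤
      (((4 * Real.log 3 + Real.log (9 * Q ^ 2)) / Q : ℝ) : EReal) := by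
  refine iSup₂_le fun U hU => ?_
  obtain ⟨V, hV, hVsymm, hVU⟩ := comp_symm_mem_uniformity_sets hU
  obtain ⟨M, hM⟩ := exists_agree_of_mem_uniformity hV
  obtain ⟨B₀, hB₀⟩ := exists_setX_subset_sparseSet hq Q
  set B := max B₀ M
  have hQ : (0 : ℝ) < Q := by exact_mod_cast Nat.pos_of_neZero Q
  have hbound : ∀ N : ℕ, 1 ≤ N → Dynamics.coverEntropyEntourage Tskew (setX q) U ≤
      ((((2 * M + 3 * B + 1) * Real.log 3 / Q) * (N : ℝ)⁻¹ +
        (4 * Real.log 3 + Real.log (9 * Q ^ 2)) / Q : ℝ) : EReal) := by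
    intro N hN
    obtain ⟨s, hs, hcard⟩ := exists_isDynCoverOf_sparseSet (B := B) (Q := Q)
      (le_max_right B₀ M) N hM
    have hNQ : N * Q ≠ 0 := mul_ne_zero (by omega) (NeZero.ne Q)
    have hN' : (0 : ℝ) < N := by exact_mod_cast hN
    calc Dynamics.coverEntropyEntourage Tskew (setX q) U
        ≤ Dynamics.coverEntropyEntourage Tskew (sparseSet B Q) U :=
          Dynamics.coverEntropyEntourage_monotone _ _ (hB₀ B (le_max_left _ _))
      _ ≤ Dynamics.coverEntropyEntourage Tskew (sparseSet B Q) (SetRel.comp V V) :=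
          Dynamics.coverEntropyEntourage_antitone _ _ hVU
      _ ≤ ENNReal.log s.card / (N * Q : ℕ) :=
          hs.coverEntropyEntourage_le_log_card_div (mapsTo_Tskew_sparseSet B Q) hNQ
      _ ≤ ENNReal.log (ENNReal.ofReal
            (3 ^ (B + 2 * (M + B + 2 * N) + 1) * (9 * Q ^ 2) ^ N)) / (N * Q : ℕ) := by
          refine EReal.div_le_div_right_of_nonneg (by positivity) (ENNReal.log_monotone ?_)
          rw [← ENNReal.ofReal_natCast]
          exact ENNReal.ofReal_le_ofReal (by exact_mod_cast hcard)
      _ = _ := by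
          rw [ENNReal.log_ofReal_of_pos (by positivity), Real.log_mul (by positivity)
            (by positivity), Real.log_pow, Real.log_pow, ← EReal.coe_natCast, ← EReal.coe_div]
          congr 1
          push_cast
          field_simp
          ring
  have hlim : Tendsto (fun N : ℕ => ((2 * M + 3 * B + 1) * Real.log 3 / Q) * (N : ℝ)⁻¹ +
      (4 * Real.log 3 + Real.log (9 * Q ^ 2)) / Q) atTop
      (𝓝 ((4 * Real.log 3 + Real.log (9 * Q ^ 2)) / Q)) := by
    simpa using (tendsto_inv_atTop_nhds_zero_nat (𝕜 := ℝ)).const_mul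
      ((2 * M + 3 * B + 1) * Real.log 3 / Q) |>.add_const
        ((4 * Real.log 3 + Real.log (9 * Q ^ 2)) / Q)
  exact ge_of_tendsto ((continuous_coe_real_ereal.tendsto _).comp hlim)
    (eventually_atTop.2 ⟨1, hbound⟩)

theorem setX_nonempty (q : ℕ → ℕ) : (setX q).Nonempty := by
  obtain ⟨y, hy⟩ := setP_nonempty q
  exact ⟨(y, fun _ => 1), subset_closure
    (Set.mem_iUnion.2 ⟨0, (y, fun _ => 1), ⟨hy, fun _ => Or.inr rfl⟩, rfl⟩)⟩

/-- the subshift `(X,T)` has topological entropy zero. -/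
theorem stmt_17 (q : ℕ → ℕ) (hq1 : ∀ k, 1 ≤ q k)
    (hq : Filter.Tendsto q Filter.atTop Filter.atTop) :
    Dynamics.coverEntropy Tskew (setX q) = 0 := by
  refine le_antisymm ?_ (Dynamics.coverEntropy_nonneg Tskew (setX_nonempty q))
  have hlog : Tendsto (fun Q : ℕ => Real.log Q / Q) atTop (𝓝 0) :=
    Real.isLittleO_log_id_atTop.tendsto_div_nhds_zero.comp tendsto_natCast_atTop_atTop
  have hlim : Tendsto (fun Q : ℕ => (4 * Real.log 3 + Real.log (9 * (Q : ℝ) ^ 2)) / Q) atTop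
      (𝓝 0) := by
    have := ((tendsto_inv_atTop_nhds_zero_nat (𝕜 := ℝ)).const_mul
      (4 * Real.log 3 + Real.log 9)).add (hlog.const_mul 2)
    simp only [mul_zero, add_zero] at this
    refine this.congr' (eventually_atTop.2 ⟨1, fun Q hQ => ?_⟩)
    have hQ' : (0 : ℝ) < Q := by exact_mod_cast hQ
    dsimp only
    rw [Real.log_mul (by norm_num) (by positivity), Real.log_pow]
    field_simp
    push_cast
    ring
  refine ge_of_tendsto ((continuous_coe_real_ereal.tendsto _).comp hlim)
    (eventually_atTop.2 ⟨1, fun Q hQ => ?_⟩)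
  have : NeZero Q := ⟨by omega⟩
  exact coverEntropy_setX_le hq Q
end
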